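/- Let S ⊆ R satisfy S = S(ρ_S) with max ρ_S > 0, where 2ρ_S = Σ_{α∈S} α. If 𝔭 is any parabolic subalgebra of 𝔤 containing 𝔥 whose unique irreducible ad-nilpotent ideal equals ⊕_{α∈S} 𝔤_α, then 𝔭 ⊆ 𝔭_{ρ_S}. -/

import Mathlib

open RealInnerProductSpace

structure RootSys (n : ℕ) where
  R : Set (EuclideanSpace ℝ (Fin n))
  finite : R.Finite
  zero_not_mem : (0 : EuclideanSpace ℝ (Fin n)) ∉ R
  spans : Submodule.span ℝ R = ⊤
  neg_mem : ∀ α ∈ R, -α ∈ R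
  reduced : ∀ α ∈ R, ∀ t : ℝ, t • α ∈ R → t = 1 ∨ t = -1
  reflect_mem : ∀ α ∈ R, ∀ β ∈ R, β - (2 * ⟪α, β⟫ / ⟪α, α⟫) • α ∈ R
  crystal : ∀ α ∈ R, ∀ β ∈ R, ∃ k : ℤ, 2 * ⟪α, β⟫ / ⟪α, α⟫ = (k : ℝ)
  irreducible : ∀ S ⊆ R, (∀ α ∈ S, ∀ β ∈ R \ S, ⟪α, β⟫ = 0) → S = ∅ ∨ S = R


section Lie

variable (L : Type*) [LieRing L] [LieAlgebra ℂ L]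

/-- `i` is an ideal of the subalgebra (given as a submodule) `p`. -/
def IsIdealOf (p i : Submodule ℂ L) : Prop :=
  i ≤ p ∧ ∀ x ∈ p, ∀ y ∈ i, ⁅x, y⁆ ∈ i

/-- Every element of `i` is ad-nilpotent. -/
def IsAdNilpotentSub (i : Submodule ℂ L) : Prop :=
  ∀ y ∈ i, IsNilpotent (LieAlgebra.ad ℂ L y)

/-- `i` is nonzero and irreducible as a module over `m` (under the bracket action). -/
def IsIrreducibleOver (m i : Submodule ℂ L) : Prop :=
  i ≠ ⊥ ∧ ∀ j : Submodule ℂ L, j ≤ i →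
    (∀ x ∈ m, ∀ y ∈ j, ⁅x, y⁆ ∈ j) → j = ⊥ ∨ j = i

end Lie

open LieModule LieAlgebra LieAlgebra.IsKilling in
/-- If `a`, `b` and `b + a` are weights with `b` nonzero then `[g_b, g_a] ≠ 0`. -/
theorem exists_lie_ne_zero_aux {L : Type*} [LieRing L] [LieAlgebra ℂ L] [LieAlgebra.IsKilling ℂ L]
    [FiniteDimensional ℂ L] (H : LieSubalgebra ℂ L) [H.IsCartanSubalgebra]
    (b a : Weight ℂ H L) (hb : b.IsNonZero)
    (hab : rootSpace H ((b : H → ℂ) + (a : H → ℂ)) ≠ ⊥) :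
    ∃ e ∈ rootSpace H b, ∃ x ∈ rootSpace H a, ⁅e, x⁆ ≠ 0 := by
  have hk : (1 : ℤ) ≤ chainTopCoeff b a :=
    ((rootSpace_zsmul_add_ne_bot_iff b a hb 1).mp (by simpa using hab)).1
  obtain ⟨v, hv, v_ne0⟩ := (chainTop b a).exists_ne_zero
  obtain ⟨h, e, f, isSl2, he, hf⟩ := exists_isSl2Triple_of_weight_isNonZero hb
  obtain rfl := isSl2.h_eq_coroot hb he hf
  have prim : isSl2.HasPrimitiveVectorWith v (chainLength b a : ℂ) :=
    have := lie_mem_genWeightSpace_of_mem_genWeightSpace he hv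
    ⟨v_ne0, (chainLength_smul _ _ hv).symm, by rwa [genWeightSpace_add_chainTop _ _ hb] at this⟩
  obtain ⟨k, hk'⟩ : ∃ k, chainTopCoeff b a = k + 1 := ⟨chainTopCoeff b a - 1, by omega⟩
  have hle : k + 1 ≤ chainLength b a := hk' ▸ chainTopCoeff_le_chainLength b a
  refine ⟨e, he, ((toEnd ℂ L L f) ^ (k + 1)) v, ?_, ?_⟩
  · have := toEnd_pow_apply_mem hf hv (k + 1)
    rw [coe_chainTop', hk'] at this
    simpa using this
  · rw [prim.lie_e_pow_succ_toEnd_f]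
    refine smul_ne_zero (mul_ne_zero (by exact_mod_cast Nat.succ_ne_zero k) ?_)
      (prim.pow_toEnd_f_ne_zero_of_eq_nat rfl (by omega))
    rw [sub_ne_zero]
    exact_mod_cast (by omega : chainLength b a ≠ k)

/-- Roots at an obtuse angle which are not opposite add up to a root. -/
theorem RootSys.add_mem_aux {n : ℕ} (RS : RootSys n) {α β : EuclideanSpace ℝ (Fin n)}
    (hα : α ∈ RS.R) (hβ : β ∈ RS.R) (h : ⟪α, β⟫ < 0) (hne : α + β ≠ 0) : α + β ∈ RS.R := by
  have hα0 : α ≠ 0 := fun h0 => RS.zero_not_mem (h0 ▸ hα)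
  have hβ0 : β ≠ 0 := fun h0 => RS.zero_not_mem (h0 ▸ hβ)
  have hαα : 0 < ⟪α, α⟫ := real_inner_self_pos.mpr hα0
  have hββ : 0 < ⟪β, β⟫ := real_inner_self_pos.mpr hβ0
  have hsum : 0 < ⟪α + β, α + β⟫ := real_inner_self_pos.mpr hne
  rw [real_inner_add_add_self] at hsum
  obtain ⟨k, hk⟩ := RS.crystal α hα β hβ
  obtain ⟨l, hl⟩ := RS.crystal β hβ α hα
  by_cases hk1 : k = -1
  · have := RS.reflect_mem α hα β hβ
    rw [hk, hk1] at this
    simpa [add_comm] using this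
  by_cases hl1 : l = -1
  · have := RS.reflect_mem β hβ α hα
    rw [hl, hl1] at this
    simpa [add_comm] using this
  exfalso
  rw [real_inner_comm] at hl
  rw [div_eq_iff hαα.ne'] at hk
  rw [div_eq_iff hββ.ne'] at hl
  have hk0 : (k : ℝ) < 0 := by by_contra hc; push Not at hc; nlinarith
  have hl0 : (l : ℝ) < 0 := by by_contra hc; push Not at hc; nlinarith
  have hk0' : k < 0 := by exact_mod_cast hk0
  have hl0' : l < 0 := by exact_mod_cast hl0
  have hk2 : (k : ℝ) ≤ -2 := by exact_mod_cast (by omega : k ≤ -2)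
  have hl2 : (l : ℝ) ≤ -2 := by exact_mod_cast (by omega : l ≤ -2)
  nlinarith

/-- If `S = S(ρ_S)` with `max ρ_S > 0` and `𝔭` is any parabolic subalgebra containing
`𝔥` whose unique irreducible ad-nilpotent ideal is `⊕_{α ∈ S} 𝔤_α`, then
`𝔭 ⊆ 𝔭_{ρ_S}`. -/
theorem stmt_19 {n : ℕ} (RS : RootSys n) (S : Set (EuclideanSpace ℝ (Fin n)))
    (hSR : S ⊆ RS.R)
    (T : Finset (EuclideanSpace ℝ (Fin n))) (hT : (T : Set (EuclideanSpace ℝ (Fin n))) = S)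
    (rho : EuclideanSpace ℝ (Fin n)) (hrho : (2 : ℝ) • rho = ∑ α ∈ T, α)
    (M : ℝ) (hM : IsGreatest ((fun α => ⟪rho, α⟫) '' RS.R) M) (hMpos : 0 < M)
    (hS : S = {α ∈ RS.R | ⟪rho, α⟫ = M})
    (L : Type*) [LieRing L] [LieAlgebra ℂ L] [LieAlgebra.IsSimple ℂ L]
    [FiniteDimensional ℂ L]
    (H : LieSubalgebra ℂ L) [H.IsCartanSubalgebra]
    (rt : EuclideanSpace ℝ (Fin n) → (H → ℂ))
    (hrt0 : rt 0 = 0)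
    (hrtinj : Set.InjOn rt (RS.R ∪ {0}))
    (hrtneg : ∀ α ∈ RS.R, rt (-α) = -rt α)
    (hrtadd : ∀ α ∈ RS.R, ∀ β ∈ RS.R, α + β ∈ RS.R → rt (α + β) = rt α + rt β)
    (hrootne : ∀ α ∈ RS.R, (LieAlgebra.rootSpace H (rt α)).toSubmodule ≠ ⊥)
    (hdec : H.toSubmodule ⊔
        (⨆ α ∈ RS.R, (LieAlgebra.rootSpace H (rt α)).toSubmodule) = ⊤)
    -- `𝔭` is a parabolic subalgebra containing `𝔥`, given by a closed set of
    -- roots `P` with `P ∪ (-P) = R`: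
    (P : Set (EuclideanSpace ℝ (Fin n))) (hPR : P ⊆ RS.R)
    (hPclosed : ∀ α ∈ P, ∀ β ∈ P, α + β ∈ RS.R → α + β ∈ P)
    (hPfull : ∀ α ∈ RS.R, α ∈ P ∨ -α ∈ P)
    (p m iS : Submodule ℂ L)
    (hp : p = H.toSubmodule ⊔
        (⨆ α ∈ P, (LieAlgebra.rootSpace H (rt α)).toSubmodule))
    (hm : m = H.toSubmodule ⊔
        (⨆ α ∈ {α ∈ P | -α ∈ P}, (LieAlgebra.rootSpace H (rt α)).toSubmodule))
    (hiS : iS = ⨆ α ∈ S, (LieAlgebra.rootSpace H (rt α)).toSubmodule)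
    -- `⊕_{α ∈ S} 𝔤_α` is the unique irreducible ad-nilpotent ideal of `𝔭`:
    (hiSideal : IsIdealOf L p iS ∧ IsAdNilpotentSub L iS ∧ IsIrreducibleOver L m iS)
    (huniq : ∀ i : Submodule ℂ L,
      IsIdealOf L p i → IsAdNilpotentSub L i → IsIrreducibleOver L m i → i = iS)
    (pRho : Submodule ℂ L)
    (hpRho : pRho = H.toSubmodule ⊔
        (⨆ α ∈ {α ∈ RS.R | 0 ≤ ⟪rho, α⟫}, (LieAlgebra.rootSpace H (rt α)).toSubmodule)) :
    p ≤ pRho := by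
  have hle : ∀ (A : Set (EuclideanSpace ℝ (Fin n))), ∀ α ∈ A,
      (LieAlgebra.rootSpace H (rt α)).toSubmodule ≤
        ⨆ α ∈ A, (LieAlgebra.rootSpace H (rt α)).toSubmodule :=
    fun A α hα => le_iSup₂_of_le α hα le_rfl
  have hw : ∀ α ∈ RS.R, LieAlgebra.rootSpace H (rt α) ≠ ⊥ := fun α hα h =>
    hrootne α hα (by rw [h]; simp)
  have hnz : ∀ α ∈ RS.R, rt α ≠ 0 := fun α hα h => by
    have := hrtinj (Or.inl hα) (Or.inr rfl) (h.trans hrt0.symm)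
    exact RS.zero_not_mem (this ▸ hα)
  suffices hmain : ∀ β ∈ P, 0 ≤ ⟪rho, β⟫ by
    rw [hp, hpRho]
    refine sup_le_sup_left (iSup₂_le fun β hβ => ?_) _
    exact hle _ β ⟨hPR hβ, hmain β hβ⟩
  intro β hβP
  by_contra hneg
  push Not at hneg
  have hβ : β ∈ RS.R := hPR hβP
  obtain ⟨α, hαT, hαβ⟩ : ∃ α ∈ T, ⟪α, β⟫ < 0 := by
    by_contra hc
    push Not at hc
    have h2 : ⟪(2 : ℝ) • rho, β⟫ = ∑ α ∈ T, ⟪α, β⟫ := by rw [hrho, sum_inner]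
    rw [real_inner_smul_left] at h2
    have := Finset.sum_nonneg hc
    linarith
  have hαS : α ∈ S := hT ▸ hαT
  have hα : α ∈ RS.R := hSR hαS
  obtain ⟨⟨-, hid⟩, hnil, -⟩ := hiSideal
  have hgp : ∀ e ∈ LieAlgebra.rootSpace H (rt β), e ∈ p := fun e he => by
    rw [hp]
    exact (le_sup_right : _ ≤ H.toSubmodule ⊔ _) (hle P β hβP he)
  have hgi : ∀ x ∈ LieAlgebra.rootSpace H (rt α), x ∈ iS := fun x hx => by
    rw [hiS]
    exact hle S α hαS hx
  let b : LieModule.Weight ℂ H L := ⟨rt β, hw β hβ⟩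
  let a : LieModule.Weight ℂ H L := ⟨rt α, hw α hα⟩
  have hb : b.IsNonZero := hnz β hβ
  by_cases hopp : α + β = 0
  · have hαeq : α = -β := eq_neg_of_add_eq_zero_left hopp
    obtain ⟨h, e, f, t, he, hf⟩ :=
      LieAlgebra.IsKilling.exists_isSl2Triple_of_weight_isNonZero hb
    have hf' : f ∈ LieAlgebra.rootSpace H (rt α) := by
      rw [hαeq, hrtneg β hβ]; exact hf
    have hh := hid e (hgp e he) f (hgi f hf')
    rw [t.lie_e_f] at hh
    have hH : h ∈ H := by
      rw [t.h_eq_coroot hb he hf]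
      exact (LieAlgebra.IsKilling.coroot b).2
    exact t.h_ne_zero
      (LieAlgebra.IsKilling.eq_zero_of_isNilpotent_ad_of_mem_isCartanSubalgebra ℂ L H hH (hnil h hh))
  · have hsum : α + β ∈ RS.R := RS.add_mem_aux hα hβ hαβ hopp
    have hrtsum : rt β + rt α = rt (α + β) := by rw [hrtadd α hα β hβ hsum, add_comm]
    obtain ⟨e, he, x, hx, hex⟩ := exists_lie_ne_zero_aux H b a hb
      (by change LieAlgebra.rootSpace H (rt β + rt α) ≠ ⊥
          rw [hrtsum]; exact hw _ hsum)
    have hmem : ⁅e, x⁆ ∈ LieAlgebra.rootSpace H (rt (α + β)) := by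
      rw [← hrtsum]
      exact LieAlgebra.lie_mem_genWeightSpace_of_mem_genWeightSpace he hx
    have hmem2 := hid e (hgp e he) x (hgi x hx)
    have hnotS : α + β ∉ S := fun hc => by
      rw [hS] at hc hαS
      have h1 := hc.2
      rw [inner_add_right, hαS.2] at h1
      linarith
    have hind := LieModule.iSupIndep_genWeightSpace ℂ H L (rt (α + β))
    rw [← LieSubmodule.disjoint_toSubmodule, Submodule.disjoint_def] at hind
    refine hex (hind _ hmem ?_)
    rw [hiS] at hmem2
    revert hmem2
    generalize ⁅e, x⁆ = z
    revert z
    rw [← SetLike.le_def]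
    refine iSup₂_le fun γ hγ => ?_
    have hne : rt γ ≠ rt (α + β) := fun hc => by
      have := hrtinj (Or.inl (hSR hγ)) (Or.inl hsum) hc
      exact hnotS (this ▸ hγ)
    rw [LieSubmodule.toSubmodule_le_toSubmodule]
    exact le_iSup₂_of_le (f := fun χ (_ : χ ≠ rt (α + β)) => LieModule.genWeightSpace L χ)
      (rt γ) hne le_rfl
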